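/- Let A : ℝ^{n₁×n₂} → ℝ^m be a linear map satisfying the RIP of order ⌈tk⌉ with restricted isometry constant δ_{tk} satisfying δ_{tk} < √((t−1)/t) for some fixed t > 1 and positive integer k. Let X ∈ ℝ^{n₁×n₂}, n ∈ ℝ^m with ‖n‖₂ ≤ ε, b = A(X) + n, λ > 0, let X♯ be a minimizer of Z ↦ ‖Z‖_* + (1/(2λ))‖b − A(Z)‖₂², set H = X♯ − X and E = {1,…,k}. Then ‖H_E‖_F ≤ [2√k·β₁(1+β₂)λ + 4β₂ε] / [(1−β₂)(k·β₁·λ + √k·ε)]·‖X_{E^c}‖_* + [2(√k·β₁·λ + β₂ε)(√k·β₁·λ + ε)] / [√k(1−β₂)λ], where β₁ = 2/((1−δ_{tk})√(1+δ_{tk})) and β₂ = δ_{tk}/√((1−δ_{tk}²)(t−1)). -/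

import Mathlib

open Finset

/-- Frobenius norm of a real matrix. -/
noncomputable def frobNorm {n₁ n₂ : ℕ} (M : Matrix (Fin n₁) (Fin n₂) ℝ) : ℝ :=
  Real.sqrt (∑ i, ∑ j, M i j ^ 2)

/-- Nuclear norm of a real matrix: sum of its singular values, i.e. of the
square roots of the eigenvalues of `M * Mᵀ`. -/
noncomputable def nucNorm {n₁ n₂ : ℕ} (M : Matrix (Fin n₁) (Fin n₂) ℝ) : ℝ :=
  ∑ i, Real.sqrt ((Matrix.isHermitian_mul_conjTranspose_self M).eigenvalues i)

/-- `A` satisfies the RIP of order `r` with constant `δ`. -/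
def HasRIP {n₁ n₂ m : ℕ} (A : Matrix (Fin n₁) (Fin n₂) ℝ →ₗ[ℝ] EuclideanSpace ℝ (Fin m))
    (r : ℕ) (δ : ℝ) : Prop :=
  ∀ M : Matrix (Fin n₁) (Fin n₂) ℝ, M.rank ≤ r →
    (1 - δ) * frobNorm M ^ 2 ≤ ‖A M‖ ^ 2 ∧ ‖A M‖ ^ 2 ≤ (1 + δ) * frobNorm M ^ 2

/-- The rank-one matrix `s • u vᵀ`. -/
noncomputable def rank1 {n₁ n₂ : ℕ} (s : ℝ) (u : Fin n₁ → ℝ) (v : Fin n₂ → ℝ) :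
    Matrix (Fin n₁) (Fin n₂) ℝ :=
  Matrix.of fun a b => s * u a * v b

theorem exists_sparse_map_le {ι : Type*} [Fintype ι] [DecidableEq ι] (f : (ι → ℝ) →ₗ[ℝ] ℝ)
    (α : ℝ) (s : ℕ) (v : ι → ℝ) (h0 : ∀ i, 0 ≤ v i) (h1 : ∀ i, v i ≤ α)
    (hs : ∑ i, v i ≤ s * α) :
    ∃ u : ι → ℝ, (∀ i, 0 ≤ u i) ∧ (∀ i, u i ≤ α) ∧ (∀ i, v i = 0 → u i = 0) ∧
      #{i | u i ≠ 0} ≤ s ∧ f u ≤ f v := by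
  induction hn : #{i | v i ≠ 0 ∧ v i ≠ α} using Nat.strong_induction_on generalizing v with
  | _ n ih =>
  by_cases hlt : 1 < #{i | v i ≠ 0 ∧ v i ≠ α}
  · obtain ⟨i, hi, j, hj, hij, hf⟩ : ∃ i, (v i ≠ 0 ∧ v i ≠ α) ∧ ∃ j, (v j ≠ 0 ∧ v j ≠ α) ∧ i ≠ j ∧
        f (Pi.single i 1 - Pi.single j 1) ≤ 0 := by
      obtain ⟨i, hi, j, hj, hij⟩ := Finset.one_lt_card.1 hlt
      simp only [mem_filter, mem_univ, true_and] at hi hj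
      rcases le_total (f (Pi.single i 1 - Pi.single j 1)) 0 with h | h
      · exact ⟨i, hi, j, hj, hij, h⟩
      · refine ⟨j, hj, i, hi, hij.symm, ?_⟩
        rw [← neg_sub, map_neg]
        linarith
    set a := min (α - v i) (v j) with ha
    have ha1 : a ≤ α - v i := min_le_left _ _
    have ha2 : a ≤ v j := min_le_right _ _
    have ha0 : 0 ≤ a := le_min (sub_nonneg.2 (h1 i)) (h0 j)
    set w : ι → ℝ := v + a • (Pi.single i 1 - Pi.single j 1) with hw
    have hwi : w i = v i + a := by simp [hw, hij]
    have hwj : w j = v j - a := by simp [hw, hij.symm, sub_eq_add_neg]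
    have hwl : ∀ l, l ≠ i → l ≠ j → w l = v l := fun l hl hl' => by simp [hw, hl, hl']
    have hsum : ∑ l, w l = ∑ l, v l := by
      simp [hw, sum_add_distrib, ← mul_sum, sum_sub_distrib]
    have hi0 : 0 < v i := lt_of_le_of_ne (h0 i) (Ne.symm hi.1)
    have hfw : f w ≤ f v := by
      rw [hw, map_add, map_smul, smul_eq_mul]
      nlinarith
    have hsub : #{l | w l ≠ 0 ∧ w l ≠ α} < n := by
      rw [← hn]
      apply Finset.card_lt_card
      refine (Finset.ssubset_iff_of_subset ?_).2 ?_
      · intro l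
        simp only [mem_filter, mem_univ, true_and]
        intro hl
        by_cases hli : l = i
        · exact hli ▸ hi
        by_cases hlj : l = j
        · exact hlj ▸ hj
        · rwa [← hwl l hli hlj]
      · rcases min_choice (α - v i) (v j) with h | h
        · refine ⟨i, by simpa using hi, ?_⟩
          have : w i = α := by rw [hwi, ha, h]; ring
          simp [this]
        · refine ⟨j, by simpa using hj, ?_⟩
          have : w j = 0 := by rw [hwj, ha, h]; ring
          simp [this]
    obtain ⟨u, hu0, hu1, huv, hus, huf⟩ := ih _ hsub w (fun l => by
        by_cases hli : l = i
        · subst hli; rw [hwi]; linarith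
        by_cases hlj : l = j
        · subst hlj; rw [hwj]; linarith
        · rw [hwl l hli hlj]; exact h0 l) (fun l => by
        by_cases hli : l = i
        · subst hli; rw [hwi]; linarith
        by_cases hlj : l = j
        · subst hlj; rw [hwj]; linarith [h1 l]
        · rw [hwl l hli hlj]; exact h1 l) (hsum ▸ hs) rfl
    refine ⟨u, hu0, hu1, fun l hl => huv l ?_, hus, huf.trans hfw⟩
    rw [hwl l (fun h => hi.1 (h ▸ hl)) (fun h => hj.1 (h ▸ hl)), hl]
  · refine ⟨v, h0, h1, fun _ h => h, ?_, le_rfl⟩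
    by_contra! hc
    have hα : 0 < α := by
      obtain ⟨i, hi⟩ := Finset.card_pos.1 (lt_of_le_of_lt (Nat.zero_le _) hc)
      simp only [mem_filter, mem_univ, true_and] at hi
      exact (lt_of_le_of_ne (h0 i) (Ne.symm hi)).trans_le (h1 i)
    have hsplit : ({i | v i ≠ 0} : Finset ι) =
        ({i | v i ≠ 0 ∧ v i ≠ α} : Finset ι) ∪ ({i | v i = α} : Finset ι) := by
      ext l
      simp only [mem_filter, mem_univ, true_and, mem_union]
      by_cases hl : v l = α
      · simp [hl, hα.ne']
      · simp [hl]
    have hdisj : Disjoint ({i | v i ≠ 0 ∧ v i ≠ α} : Finset ι) ({i | v i = α} : Finset ι) := by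
      rw [Finset.disjoint_left]
      simp +contextual
    have hsumle : ∑ l ∈ ({i | v i ≠ 0 ∧ v i ≠ α} : Finset ι), v l +
        #{i | v i = α} * α ≤ s * α := by
      refine le_trans ?_ hs
      rw [← sum_filter_ne_zero (s := univ) (f := v), ← nsmul_eq_mul, hsplit, sum_union hdisj,
        ← sum_const]
      refine add_le_add le_rfl (sum_le_sum fun l hl => ?_)
      simp at hl
      exact hl.ge
    rw [hsplit, card_union_of_disjoint hdisj] at hc
    rcases Finset.eq_empty_or_nonempty ({i | v i ≠ 0 ∧ v i ≠ α} : Finset ι) with he | hne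
    · rw [he] at hc hsumle
      simp only [card_empty, zero_add, sum_empty] at hc hsumle
      have : ((#{i | v i = α} : ℕ) : ℝ) ≤ s := le_of_mul_le_mul_right hsumle hα
      exact absurd (by exact_mod_cast this) (not_le.2 hc)
    · have hpos : 0 < ∑ l ∈ ({i | v i ≠ 0 ∧ v i ≠ α} : Finset ι), v l := by
        refine sum_pos (fun l hl => ?_) hne
        simp only [mem_filter, mem_univ, true_and] at hl
        exact lt_of_le_of_ne (h0 l) (Ne.symm hl.1)
      have : ((#{i | v i = α} : ℕ) : ℝ) < s :=
        lt_of_mul_lt_mul_right (by linarith) hα.le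
      have : #{i | v i = α} < s := by exact_mod_cast this
      omega

/-- A restricted isometry satisfies a lower bound on correlations of orthogonal sparse pieces. -/
theorem le_inner_of_rip {V F : Type*} [AddCommGroup V] [Module ℝ V] [NormedAddCommGroup F]
    [InnerProductSpace ℝ F] (B : V →ₗ[ℝ] F) (δ : ℝ) (hδ : 0 < δ) (p u : V) (P U : ℝ)
    (h : ∀ a c : ℝ, (1 - δ) * (a ^ 2 * P + c ^ 2 * U) ≤ ‖B (a • p + c • u)‖ ^ 2 ∧
      ‖B (a • p + c • u)‖ ^ 2 ≤ (1 + δ) * (a ^ 2 * P + c ^ 2 * U)) :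
    (1 - δ ^ 2) / 2 * P - δ ^ 2 / 2 * U ≤ inner ℝ (B p) (B p + B u) := by
  have h1 := (h (1 - δ) (-δ)).2
  have h2 := (h (1 + δ) δ).1
  simp only [map_add, map_smul, norm_add_sq_real, norm_smul, inner_smul_left, inner_smul_right,
    mul_pow, Real.norm_eq_abs, sq_abs, RCLike.conj_to_real] at h1 h2
  rw [inner_add_right, real_inner_self_eq_norm_sq]
  have : 4 * δ * ((1 - δ ^ 2) / 2 * P - δ ^ 2 / 2 * U) ≤
      4 * δ * (‖B p‖ ^ 2 + inner ℝ (B p) (B u)) := by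
    linarith
  exact le_of_mul_le_mul_left this (by positivity)

theorem le_of_rip_estimate {k t δ Q a τ : ℝ} (hk' : 0 < k) (ht : 1 < t) (hδ : 0 < δ)
    (hδ1 : δ < 1) (ha : 0 ≤ a) (hτ0 : 0 ≤ τ)
    (h : (1 - δ ^ 2) / 2 * Q ^ 2 ≤
      √(1 + δ) * Q * a + δ ^ 2 / 2 * (τ ^ 2 / (k * (t - 1)))) :
    Q ≤ 2 / ((1 - δ) * √(1 + δ)) * a + δ / √((1 - δ ^ 2) * (t - 1)) * (τ / √k) := by
  set S := √(1 + δ) with hS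
  have hS0 : 0 < S := Real.sqrt_pos.2 (by linarith)
  have hS2 : S ^ 2 = 1 + δ := Real.sq_sqrt (by linarith)
  have h1δ : 0 < 1 - δ ^ 2 := by nlinarith
  set b₁ := 2 / ((1 - δ) * S) * a with hb₁
  set b₂ := δ / √((1 - δ ^ 2) * (t - 1)) * (τ / √k) with hb₂
  have hb₁0 : 0 ≤ b₁ := by
    have : 0 < 1 - δ := by linarith
    positivity
  have hb₂0 : 0 ≤ b₂ := by positivity
  have hb₂2 : b₂ ^ 2 = δ ^ 2 / (1 - δ ^ 2) * (τ ^ 2 / (k * (t - 1))) := by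
    have : 0 < t - 1 := by linarith
    rw [hb₂, mul_pow, div_pow, div_pow, Real.sq_sqrt (by positivity), Real.sq_sqrt hk'.le]
    field_simp
  have hb₁2 : (1 - δ ^ 2) / 2 * b₁ = S * a := by
    have h3 : 1 - δ ≠ 0 := by linarith
    rw [hb₁]
    field_simp
    rw [hS2]
    ring
  have hmain : Q ^ 2 ≤ b₂ ^ 2 + b₁ * Q := by
    have h4 : (1 - δ ^ 2) / 2 * Q ^ 2 ≤ (1 - δ ^ 2) / 2 * (b₂ ^ 2 + b₁ * Q) := by
      have h5 : (1 - δ ^ 2) / 2 * b₂ ^ 2 = δ ^ 2 / 2 * (τ ^ 2 / (k * (t - 1))) := by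
        rw [hb₂2]; field_simp
      rw [mul_add, h5, ← mul_assoc, hb₁2]
      linarith
    exact le_of_mul_le_mul_left h4 (by linarith)
  by_contra! hlt
  nlinarith

/-- Robust null space property from the restricted isometry property, for vectors. -/
theorem robust_null_space_of_rip {ι F : Type*} [Fintype ι] [DecidableEq ι] [NormedAddCommGroup F]
    [InnerProductSpace ℝ F] (B : (ι → ℝ) →ₗ[ℝ] F) (k r : ℕ) (t δ : ℝ) (hk : 0 < k) (ht : 1 < t)
    (hr : t * k ≤ r) (hδ : 0 < δ) (hδ1 : δ < 1)
    (hB : ∀ c : ι → ℝ, #{i | c i ≠ 0} ≤ r →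
      (1 - δ) * ∑ i, c i ^ 2 ≤ ‖B c‖ ^ 2 ∧ ‖B c‖ ^ 2 ≤ (1 + δ) * ∑ i, c i ^ 2)
    (σ : ι → ℝ) (hσ : ∀ i, 0 ≤ σ i) (E : Finset ι) (hE : #E ≤ k) :
    √(∑ i ∈ E, σ i ^ 2) ≤ 2 / ((1 - δ) * √(1 + δ)) * ‖B σ‖ +
      δ / √((1 - δ ^ 2) * (t - 1)) * ((∑ i ∈ Eᶜ, σ i) / √k) := by
  have hk' : (0 : ℝ) < k := by exact_mod_cast hk
  have hkr : k < r := by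
    have : (k : ℝ) < r := by nlinarith
    exact_mod_cast this
  obtain ⟨s, rfl⟩ : ∃ s, r = k + s := ⟨r - k, by omega⟩
  have hs : 0 < s := by omega
  have hs' : (0 : ℝ) < s := by exact_mod_cast hs
  set τ := ∑ i ∈ Eᶜ, σ i with hτ
  have hτ0 : 0 ≤ τ := sum_nonneg fun i _ => hσ i
  set α := τ / s with hα
  have hα0 : 0 ≤ α := by positivity
  have hαs : s * α = τ := by rw [hα]; field_simp
  set N : Finset ι := Eᶜ.filter fun i => α < σ i with hN
  set N' : Finset ι := Eᶜ.filter fun i => ¬ α < σ i with hN'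
  have hsplit : ∑ i ∈ N, σ i + ∑ i ∈ N', σ i = τ := sum_filter_add_sum_filter_not _ _ _
  have hNα : #N * α ≤ ∑ i ∈ N, σ i := by
    rw [← nsmul_eq_mul, ← sum_const]
    exact sum_le_sum fun i hi => (mem_filter.1 hi).2.le
  have hNs : #N ≤ s := by
    rcases hτ0.eq_or_lt with h0 | hpos
    · have : N = ∅ := by
        rw [hN, filter_eq_empty_iff]
        intro i hi
        have := (sum_eq_zero_iff_of_nonneg fun i _ => hσ i).1 (hτ.symm.trans h0.symm) i hi
        simp [this, hα0]
      simp [this]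
    · have hαp : 0 < α := by positivity
      have h2 : (#N : ℝ) * α ≤ s * α := by
        have : 0 ≤ ∑ i ∈ N', σ i := sum_nonneg fun i _ => hσ i
        linarith
      exact_mod_cast le_of_mul_le_mul_right h2 hαp
  set q : ι → ℝ := fun i => if i ∈ N' then σ i else 0 with hq
  set p : ι → ℝ := fun i => if i ∈ N' then 0 else σ i with hp
  have hpq : p + q = σ := by
    ext i
    by_cases hi : i ∈ N' <;> simp [hp, hq, hi]
  obtain ⟨u, hu0, hu1, huv, hus, huf⟩ := exists_sparse_map_le
    ((innerₛₗ ℝ (B p)).comp B) α (s - #N) q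
    (fun i => by simp only [hq]; split_ifs <;> simp [hσ])
    (fun i => by
      simp only [hq]; split_ifs with h
      · exact not_lt.1 (mem_filter.1 h).2
      · exact hα0)
    (by
      simp only [hq, sum_ite_mem, univ_inter]
      rw [Nat.cast_sub hNs, sub_mul]
      linarith)
  simp only [LinearMap.comp_apply, innerₛₗ_apply_apply] at huf
  have hup : ∀ i, p i * u i = 0 := fun i => by
    by_cases hi : i ∈ N'
    · simp [hp, hi]
    · simp [huv i (by simp [hq, hi])]
  have hsupp : ∀ a c : ℝ, #{i | (a • p + c • u) i ≠ 0} ≤ k + s := fun a c => by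
    have hsub : ({i | (a • p + c • u) i ≠ 0} : Finset ι) ⊆ E ∪ N ∪ ({i | u i ≠ 0} : Finset ι) := by
      intro i
      simp only [mem_filter, mem_univ, true_and, mem_union]
      contrapose!
      rintro ⟨⟨h1, h2⟩, h3⟩
      have : i ∈ N' := by
        rw [hN', mem_filter]
        refine ⟨by simpa using h1, fun h => h2 ?_⟩
        rw [hN, mem_filter]
        exact ⟨by simpa using h1, h⟩
      simp [h3, hp, this]
    have := card_le_card hsub
    have h1 := card_union_le (E ∪ N) ({i | u i ≠ 0} : Finset ι)
    have h2 := card_union_le E N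
    omega
  have hsq : ∀ a c : ℝ, ∑ i, (a • p + c • u) i ^ 2 =
      a ^ 2 * ∑ i, p i ^ 2 + c ^ 2 * ∑ i, u i ^ 2 := fun a c => by
    rw [mul_sum, mul_sum, ← sum_add_distrib]
    refine sum_congr rfl fun i _ => ?_
    simp only [Pi.add_apply, Pi.smul_apply, smul_eq_mul]
    linear_combination 2 * a * c * hup i
  have hkey := le_inner_of_rip B δ hδ p u (∑ i, p i ^ 2) (∑ i, u i ^ 2) fun a c => by
    rw [← hsq]
    exact hB _ (hsupp a c)
  set Q := √(∑ i, p i ^ 2) with hQ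
  have hQ0 : 0 ≤ Q := Real.sqrt_nonneg _
  have hQ2 : Q ^ 2 = ∑ i, p i ^ 2 := Real.sq_sqrt (sum_nonneg fun i _ => sq_nonneg _)
  have hBp : ‖B p‖ ≤ √(1 + δ) * Q := by
    have := (hB p (by simpa using hsupp 1 0)).2
    rw [← hQ2] at this
    refine (sq_le_sq₀ (norm_nonneg _) (by positivity)).1 ?_
    rw [mul_pow, Real.sq_sqrt (by linarith)]
    exact this
  have hU : ∑ i, u i ^ 2 ≤ τ ^ 2 / s := by
    calc ∑ i, u i ^ 2 = ∑ i ∈ ({i | u i ≠ 0} : Finset ι), u i ^ 2 := by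
          rw [sum_filter]
          refine sum_congr rfl fun i _ => ?_
          split_ifs with h
          · rfl
          · simp [not_not.1 h]
      _ ≤ ∑ i ∈ ({i | u i ≠ 0} : Finset ι), α ^ 2 :=
          sum_le_sum fun i _ => pow_le_pow_left₀ (hu0 i) (hu1 i) 2
      _ = #{i | u i ≠ 0} * α ^ 2 := by rw [sum_const, nsmul_eq_mul]
      _ ≤ s * α ^ 2 := by
          have : (#{i | u i ≠ 0} : ℝ) ≤ s := by
            exact_mod_cast hus.trans (Nat.sub_le _ _)
          gcongr
      _ = τ ^ 2 / s := by rw [hα]; field_simp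
  have hts : k * (t - 1) ≤ s := by push_cast at hr; linarith
  have hU' : ∑ i, u i ^ 2 ≤ τ ^ 2 / (k * (t - 1)) := by
    refine hU.trans ?_
    have : 0 < k * (t - 1) := mul_pos hk' (by linarith)
    gcongr
  have hEQ : √(∑ i ∈ E, σ i ^ 2) ≤ Q := by
    refine Real.sqrt_le_sqrt ?_
    calc ∑ i ∈ E, σ i ^ 2 = ∑ i ∈ E, p i ^ 2 := by
          refine sum_congr rfl fun i hi => ?_
          have : i ∉ N' := fun h => by simp [hN', hi] at h
          simp [hp, this]
      _ ≤ ∑ i, p i ^ 2 := sum_le_univ_sum_of_nonneg fun i => sq_nonneg _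
  refine hEQ.trans ?_
  have hin : inner ℝ (B p) (B p + B u) ≤ √(1 + δ) * Q * ‖B σ‖ := by
    calc inner ℝ (B p) (B p + B u) ≤ inner ℝ (B p) (B σ) := by
          rw [← hpq, map_add, inner_add_right, inner_add_right]
          linarith
      _ ≤ ‖B p‖ * ‖B σ‖ := real_inner_le_norm _ _
      _ ≤ _ := by gcongr
  refine le_of_rip_estimate hk' ht hδ hδ1 (norm_nonneg _) hτ0 ?_
  rw [← hQ2] at hkey
  have : δ ^ 2 / 2 * ∑ i, u i ^ 2 ≤ δ ^ 2 / 2 * (τ ^ 2 / (k * (t - 1))) := by gcongr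
  linarith

section Interlacing

variable {V : Type*} [NormedAddCommGroup V] [InnerProductSpace ℝ V] [FiniteDimensional ℝ V]

/-- Courant–Fischer lower bound for the eigenvalues of a symmetric operator. -/
theorem le_eigenvalues_of_le_on_submodule {N : ℕ} {T : V →ₗ[ℝ] V} (hT : T.IsSymmetric)
    (hN : Module.finrank ℝ V = N) (U : Submodule ℝ V) (j : Fin N)
    (hj : (j : ℕ) < Module.finrank ℝ U) (α : ℝ)
    (h : ∀ z ∈ U, α * ‖z‖ ^ 2 ≤ inner ℝ (T z) z) : α ≤ hT.eigenvalues hN j := by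
  set e := hT.eigenvectorBasis hN with he
  let φ : U →ₗ[ℝ] (Fin j → ℝ) := LinearMap.pi fun l =>
    (innerₛₗ ℝ (e (Fin.castLE j.2.le l))).comp U.subtype
  obtain ⟨z, hz, hz0⟩ := (Submodule.ne_bot_iff _).1
    (φ.ker_ne_bot_of_finrank_lt (by simpa using hj))
  have hzl : ∀ l : Fin N, l < j → inner ℝ (e l) (z : V) = 0 := fun l hl => by
    have := congrFun (LinearMap.mem_ker.1 hz) ⟨l, hl⟩
    simpa [φ] using this
  have hT' : inner ℝ (T z) (z : V) =
      ∑ l, hT.eigenvalues hN l * inner ℝ (e l) (z : V) ^ 2 := by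
    rw [← e.sum_inner_mul_inner]
    refine sum_congr rfl fun l _ => ?_
    rw [hT, hT.apply_eigenvectorBasis, ← he, inner_smul_right, real_inner_comm]
    simp
    ring
  have hnorm : ∑ l, inner ℝ (e l) (z : V) ^ 2 = ‖(z : V)‖ ^ 2 := by
    rw [← e.sum_sq_norm_inner_right]
    simp
  have hpos : 0 < ‖(z : V)‖ ^ 2 := by
    have : (z : V) ≠ 0 := by simpa using hz0
    positivity
  refine le_of_mul_le_mul_right ((h z z.2).trans ?_) hpos
  rw [hT', ← hnorm, mul_sum]
  refine sum_le_sum fun l _ => ?_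
  rcases lt_or_ge l j with hl | hl
  · simp [hzl l hl]
  · exact mul_le_mul_of_nonneg_right (hT.eigenvalues_antitone hN hl) (sq_nonneg _)

variable {n N : ℕ} {p m : Fin n → V} {σ : Fin n → ℝ} {T : V →ₗ[ℝ] V}

theorem le_eigenvalues_of_signed_sum (hN : Module.finrank ℝ V = N) (hT : T.IsSymmetric)
    (hpm : Orthonormal ℝ (Sum.elim p m)) (hσ : ∀ i, 0 ≤ σ i) (hanti : Antitone σ)
    (hq : ∀ z, ∑ j, σ j * (inner ℝ (p j) z ^ 2 - inner ℝ (m j) z ^ 2) ≤ inner ℝ (T z) z)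
    (i : Fin n) (j : Fin N) (hij : (j : ℕ) = i) : σ i ≤ hT.eigenvalues hN j := by
  have hp : Orthonormal ℝ p := hpm.comp _ Sum.inl_injective
  let c : Fin (i + 1) → Fin n := Fin.castLE i.2
  have hc : Function.Injective c := Fin.castLE_injective _
  have hpc : Orthonormal ℝ (p ∘ c) := hp.comp _ hc
  refine le_eigenvalues_of_le_on_submodule hT hN (Submodule.span ℝ (Set.range (p ∘ c))) j
    (by rw [finrank_span_eq_card hpc.linearIndependent]; simp [hij]) _ fun z hz => ?_
  refine le_trans ?_ (hq z)
  obtain ⟨d, rfl⟩ := (Submodule.mem_span_range_iff_exists_fun ℝ).1 hz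
  set z := ∑ l, d l • (p ∘ c) l with hz
  have hpz : ∀ l, inner ℝ (p (c l)) z = d l := fun l => hpc.inner_right_fintype d l
  have hmz : ∀ l, inner ℝ (m l) z = 0 := fun l => by
    rw [hz, inner_sum]
    refine sum_eq_zero fun x _ => ?_
    rw [inner_smul_right]
    have := hpm.2 (i := Sum.inr l) (j := Sum.inl (c x)) (by simp)
    simp only [Sum.elim_inr, Sum.elim_inl] at this
    simp [this]
  have hnorm : ‖z‖ ^ 2 = ∑ l, d l ^ 2 := by
    rw [← real_inner_self_eq_norm_sq]
    nth_rw 1 [hz]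
    rw [sum_inner]
    refine sum_congr rfl fun x _ => ?_
    rw [inner_smul_left, Function.comp_apply, hpz]
    simp [sq]
  simp only [hmz]
  calc σ i * ‖z‖ ^ 2 ≤ ∑ l, σ (c l) * (inner ℝ (p (c l)) z ^ 2 - 0 ^ 2) := by
        rw [hnorm, mul_sum]
        refine sum_le_sum fun l _ => ?_
        rw [hpz, zero_pow two_ne_zero, sub_zero]
        exact mul_le_mul_of_nonneg_right
          (hanti (Fin.le_def.2 (Nat.lt_succ_iff.1 l.2))) (sq_nonneg _)
    _ = ∑ l ∈ univ.image c, σ l * (inner ℝ (p l) z ^ 2 - 0 ^ 2) := by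
        rw [sum_image hc.injOn]
    _ ≤ _ := sum_le_univ_sum_of_nonneg fun l => mul_nonneg (hσ l) (by simp [sq_nonneg])

theorem neg_le_eigenvalues_of_signed_sum (hN : Module.finrank ℝ V = N) (hT : T.IsSymmetric)
    (hm : Orthonormal ℝ m) (hσ : ∀ i, 0 ≤ σ i)
    (hq : ∀ z, ∑ j, σ j * (inner ℝ (p j) z ^ 2 - inner ℝ (m j) z ^ 2) ≤ inner ℝ (T z) z)
    (i : ℕ) (hin : i ≤ n) (j : Fin N) (hij : i + j < N) (α : ℝ) (hα : 0 ≤ α)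
    (hασ : ∀ l : Fin n, i ≤ l → σ l ≤ α) : -α ≤ hT.eigenvalues hN j := by
  let c : Fin i → Fin n := Fin.castLE hin
  have hrank := (Submodule.span ℝ (Set.range (m ∘ c))).finrank_add_finrank_orthogonal
  have hspan : Module.finrank ℝ (Submodule.span ℝ (Set.range (m ∘ c))) ≤ i := by
    simpa [Set.finrank] using finrank_range_le_card (R := ℝ) (m ∘ c)
  refine le_eigenvalues_of_le_on_submodule hT hN (Submodule.span ℝ (Set.range (m ∘ c)))ᗮ j
    (by omega) _ fun z hz => ?_
  refine le_trans ?_ (hq z)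
  have hmz : ∀ l : Fin n, (l : ℕ) < i → inner ℝ (m l) z = 0 := fun l hl =>
    (Submodule.mem_orthogonal _ _).1 hz _ (Submodule.subset_span ⟨⟨l, hl⟩, rfl⟩)
  have hbessel : ∑ l, inner ℝ (m l) z ^ 2 ≤ ‖z‖ ^ 2 := by
    simpa using hm.sum_inner_products_le z (s := univ)
  calc -α * ‖z‖ ^ 2 ≤ -α * ∑ l, inner ℝ (m l) z ^ 2 :=
        mul_le_mul_of_nonpos_left hbessel (by linarith)
    _ = ∑ l, -(α * inner ℝ (m l) z ^ 2) := by rw [mul_sum]; simp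
    _ ≤ _ := sum_le_sum fun l _ => by
        have h1 := mul_nonneg (hσ l) (sq_nonneg (inner ℝ (p l) z))
        rcases lt_or_ge (l : ℕ) i with hl | hl
        · rw [hmz l hl]; simpa using h1
        · have := mul_le_mul_of_nonneg_right (hασ l hl) (sq_nonneg (inner ℝ (m l) z))
          linarith

/-- Lidskii-type inequality for signed partial sums of symmetric spectra `±σ`. -/
theorem signed_sum_sub_le {L : Type*} [Fintype L] {p' m' : Fin n → V} {σ' : Fin n → ℝ}
    (hpm : Orthonormal ℝ (Sum.elim p m)) (hσ : ∀ i, 0 ≤ σ i) (hanti : Antitone σ)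
    (hpm' : Orthonormal ℝ (Sum.elim p' m')) (hσ' : ∀ i, 0 ≤ σ' i) (hanti' : Antitone σ')
    (s : L → ℝ) (hs : ∀ l, 0 ≤ s l) (w : L → V) (hw : ∀ l, ‖w l‖ ≤ 1)
    (hq : ∀ z, ∑ j, σ j * (inner ℝ (p j) z ^ 2 - inner ℝ (m j) z ^ 2) ≤
      ∑ j, σ' j * (inner ℝ (p' j) z ^ 2 - inner ℝ (m' j) z ^ 2) +
        ∑ l, s l * inner ℝ (w l) z ^ 2) (E : Finset (Fin n)) :
    ∑ i ∈ E, σ i - ∑ i ∈ Eᶜ, σ i ≤ ∑ i ∈ E, σ' i - ∑ i ∈ Eᶜ, σ' i + ∑ l, s l := by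
  let N := Module.finrank ℝ V
  have hN : Module.finrank ℝ V = N := rfl
  let R : V → V →ₗ[ℝ] V := fun v => (innerₛₗ ℝ v).smulRight v
  have hR : ∀ v x, R v x = inner ℝ v x • v := fun v x => rfl
  have hRs : ∀ v, (R v).IsSymmetric := fun v x y => by
    simp only [hR, inner_smul_left, inner_smul_right, RCLike.conj_to_real]
    rw [real_inner_comm v x, mul_comm]
  have hRq : ∀ v z, inner ℝ (R v z) z = inner ℝ v z ^ 2 := fun v z => by
    simp [hR, inner_smul_left, sq]
  let T : V →ₗ[ℝ] V := ∑ j, σ' j • (R (p' j) - R (m' j)) + ∑ l, s l • R (w l)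
  have hTq : ∀ z, inner ℝ (T z) z = ∑ j, σ' j * (inner ℝ (p' j) z ^ 2 - inner ℝ (m' j) z ^ 2) +
      ∑ l, s l * inner ℝ (w l) z ^ 2 := fun z => by
    simp [T, LinearMap.sum_apply, inner_add_left, sum_inner, inner_smul_left, inner_sub_left, hRq]
  have hT : T.IsSymmetric := fun x y => by
    simp [T, LinearMap.sum_apply, inner_add_left, sum_inner, inner_smul_left, inner_sub_left,
      inner_add_right, inner_sum, inner_smul_right, inner_sub_right, (hRs _ _ _)]
  set μ := hT.eigenvalues hN with hμ
  set e := hT.eigenvectorBasis hN with he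
  have hpars : ∀ v : V, ∑ i, inner ℝ v (e i) ^ 2 = ‖v‖ ^ 2 := fun v => by
    rw [← e.sum_sq_norm_inner_left]
    simp
  have htr : ∑ i, μ i ≤ ∑ l, s l := by
    have h1 : ∀ i, μ i = inner ℝ (T (e i)) (e i) := fun i => by
      rw [hT.apply_eigenvectorBasis, ← he, inner_smul_left, real_inner_self_eq_norm_sq]
      simp [hμ]
    have hp1 : ∀ j, ‖p' j‖ = 1 := fun j => hpm'.1 (Sum.inl j)
    have hm1 : ∀ j, ‖m' j‖ = 1 := fun j => hpm'.1 (Sum.inr j)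
    simp_rw [h1, hTq, sum_add_distrib]
    rw [sum_comm, sum_comm (s := (univ : Finset (Fin N))) (t := (univ : Finset L))]
    simp_rw [← mul_sum, sum_sub_distrib, hpars, hp1, hm1]
    simp only [one_pow, sub_self, mul_zero, sum_const_zero, zero_add]
    refine sum_le_sum fun l _ => mul_le_of_le_one_right (hs l) ?_
    exact pow_le_one₀ (norm_nonneg _) (hw l)
  have hq' : ∀ z, ∑ j, σ' j * (inner ℝ (p' j) z ^ 2 - inner ℝ (m' j) z ^ 2) ≤ inner ℝ (T z) z :=
    fun z => by
      rw [hTq]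
      exact le_add_of_nonneg_right (sum_nonneg fun l _ => mul_nonneg (hs l) (sq_nonneg _))
  have hqT : ∀ z, ∑ j, σ j * (inner ℝ (p j) z ^ 2 - inner ℝ (m j) z ^ 2) ≤ inner ℝ (T z) z :=
    fun z => (hq z).trans (hTq z).ge
  have h2n : n + n ≤ N := by
    simpa using hpm.linearIndependent.fintype_card_le_finrank
  let top : Fin n → Fin N := fun i => ⟨i, by omega⟩
  let bot : Fin n → Fin N := fun i => ⟨N - 1 - i, by omega⟩
  have hm := hpm.comp _ Sum.inr_injective
  have hm' := hpm'.comp _ Sum.inr_injective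
  have h1 : ∀ i, σ i ≤ μ (top i) := fun i =>
    le_eigenvalues_of_signed_sum hN hT hpm hσ hanti hqT i _ rfl
  have h2 : ∀ i, σ' i ≤ μ (top i) := fun i =>
    le_eigenvalues_of_signed_sum hN hT hpm' hσ' hanti' hq' i _ rfl
  have h3 : ∀ i, -σ i ≤ μ (bot i) := fun i =>
    neg_le_eigenvalues_of_signed_sum hN hT hm hσ hqT i i.2.le (bot i)
      (by simp only [bot]; omega) _ (hσ i) fun l hl => hanti (Fin.le_def.2 hl)
  have h4 : ∀ i, -σ' i ≤ μ (bot i) := fun i =>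
    neg_le_eigenvalues_of_signed_sum hN hT hm' hσ' hq' i i.2.le (bot i)
      (by simp only [bot]; omega) _ (hσ' i) fun l hl => hanti' (Fin.le_def.2 hl)
  have h5 : ∀ j : Fin N, n + j < N → 0 ≤ μ j := fun j hj => by
    simpa using neg_le_eigenvalues_of_signed_sum hN hT hm hσ hqT n le_rfl j hj 0 le_rfl
      fun l hl => absurd l.2 (not_lt.2 hl)
  have hinj : Function.Injective (Sum.elim top bot) := by
    refine Function.Injective.sumElim (fun a b h => ?_) (fun a b h => ?_) fun a b h => ?_ <;>
      simp only [top, bot, Fin.mk.injEq] at h <;> omega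
  have hsum : ∑ i, μ (top i) + ∑ i, μ (bot i) ≤ ∑ i, μ i := by
    calc ∑ i, μ (top i) + ∑ i, μ (bot i) = ∑ x, μ (Sum.elim top bot x) := by
          rw [Fintype.sum_sum_type]; rfl
      _ = ∑ j ∈ univ.image (Sum.elim top bot), μ j := by rw [sum_image hinj.injOn]
      _ ≤ ∑ i, μ i := by
          refine sum_le_sum_of_subset_of_nonneg (subset_univ _) fun j _ hj => h5 j ?_
          by_contra hc
          refine hj (mem_image.2 ⟨Sum.inr ⟨N - 1 - j, by omega⟩, mem_univ _, ?_⟩)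
          ext
          simp only [Sum.elim_inr, bot]
          omega
  have e1 := sum_le_sum fun i (_ : i ∈ E) => h1 i
  have e2 := sum_le_sum fun i (_ : i ∈ Eᶜ) => h2 i
  have e3 := sum_le_sum fun i (_ : i ∈ Eᶜ) => h3 i
  have e4 := sum_le_sum fun i (_ : i ∈ E) => h4 i
  rw [sum_neg_distrib] at e3 e4
  rw [← sum_add_sum_compl E (fun i => μ (top i)), ← sum_add_sum_compl E (fun i => μ (bot i))] at hsum
  linarith

end Interlacing

section MatrixSVD

open Matrix

variable {n₁ n₂ : ℕ}

theorem sum_rank1_eq_mul (c : Fin n₁ → ℝ) (u : Fin n₁ → Fin n₁ → ℝ) (v : Fin n₁ → Fin n₂ → ℝ) :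
    ∑ i, rank1 (c i) (u i) (v i) = (of u)ᵀ * diagonal c * of v := by
  ext a b
  rw [Matrix.sum_apply, Matrix.mul_apply]
  refine sum_congr rfl fun i _ => ?_
  rw [Matrix.mul_diagonal]
  simp [rank1, mul_comm (c i)]

theorem of_mul_transpose_eq_one {n : ℕ} {w : Fin n₁ → Fin n → ℝ}
    (hw : ∀ i j, ∑ a, w i a * w j a = if i = j then (1 : ℝ) else 0) : of w * (of w)ᵀ = 1 := by
  ext i j
  simp [Matrix.mul_apply, hw, Matrix.one_apply]

theorem rank_sum_rank1_le (c : Fin n₁ → ℝ) (u : Fin n₁ → Fin n₁ → ℝ) (v : Fin n₁ → Fin n₂ → ℝ) :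
    (∑ i, rank1 (c i) (u i) (v i)).rank ≤ #{i | c i ≠ 0} := by
  rw [sum_rank1_eq_mul]
  refine (rank_mul_le_left _ _).trans ((rank_mul_le_right _ _).trans ?_)
  rw [rank_diagonal, Fintype.card_subtype]

theorem sum_rank1_mul_conjTranspose {c : Fin n₁ → ℝ} {u : Fin n₁ → Fin n₁ → ℝ}
    {v : Fin n₁ → Fin n₂ → ℝ}
    (hv : ∀ i j, ∑ b, v i b * v j b = if i = j then (1 : ℝ) else 0) :
    (∑ i, rank1 (c i) (u i) (v i)) * (∑ i, rank1 (c i) (u i) (v i))ᴴ =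
      (of u)ᵀ * (diagonal (fun i => c i ^ 2) * of u) := by
  have h := of_mul_transpose_eq_one hv
  rw [sum_rank1_eq_mul, conjTranspose_eq_transpose_of_trivial, transpose_mul, transpose_mul,
    transpose_transpose, diagonal_transpose]
  simp only [Matrix.mul_assoc]
  rw [← Matrix.mul_assoc (of v), h, Matrix.one_mul, ← Matrix.mul_assoc (diagonal c),
    diagonal_mul_diagonal]
  simp only [sq]

theorem frobNorm_sum_rank1_sq {c : Fin n₁ → ℝ} {u : Fin n₁ → Fin n₁ → ℝ}
    {v : Fin n₁ → Fin n₂ → ℝ}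
    (hu : ∀ i j, ∑ a, u i a * u j a = if i = j then (1 : ℝ) else 0)
    (hv : ∀ i j, ∑ b, v i b * v j b = if i = j then (1 : ℝ) else 0) :
    frobNorm (∑ i, rank1 (c i) (u i) (v i)) ^ 2 = ∑ i, c i ^ 2 := by
  have h : ∀ M : Matrix (Fin n₁) (Fin n₂) ℝ, frobNorm M ^ 2 = (M * Mᴴ).trace := fun M => by
    have h0 : 0 ≤ ∑ i, ∑ j, M i j ^ 2 := by positivity
    rw [frobNorm, Real.sq_sqrt h0]
    simp [Matrix.trace, Matrix.mul_apply, sq]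
  rw [h, sum_rank1_mul_conjTranspose hv, trace_mul_comm, Matrix.mul_assoc,
    of_mul_transpose_eq_one hu, Matrix.mul_one, trace_diagonal]

theorem nucNorm_sum_rank1 {c : Fin n₁ → ℝ} {u : Fin n₁ → Fin n₁ → ℝ}
    {v : Fin n₁ → Fin n₂ → ℝ}
    (hu : ∀ i j, ∑ a, u i a * u j a = if i = j then (1 : ℝ) else 0)
    (hv : ∀ i j, ∑ b, v i b * v j b = if i = j then (1 : ℝ) else 0)
    (hc : ∀ i, 0 ≤ c i) :
    nucNorm (∑ i, rank1 (c i) (u i) (v i)) = ∑ i, c i := by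
  set M := ∑ i, rank1 (c i) (u i) (v i) with hM
  have hroots := (isHermitian_mul_conjTranspose_self M).roots_charpoly_eq_eigenvalues
  have hchar : (M * Mᴴ).charpoly = ∏ i, (Polynomial.X - Polynomial.C (c i ^ 2)) := by
    rw [hM, sum_rank1_mul_conjTranspose hv, charpoly_mul_comm, Matrix.mul_assoc,
      of_mul_transpose_eq_one hu, Matrix.mul_one, charpoly_diagonal]
  rw [hchar, Polynomial.roots_prod _ _ (prod_ne_zero_iff.2 fun i _ => Polynomial.X_sub_C_ne_zero _)]
    at hroots
  simp only [Polynomial.roots_X_sub_C, Multiset.bind_singleton] at hroots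
  have := congrArg (fun s => (Multiset.map Real.sqrt s).sum) hroots
  simp only [Multiset.map_map, Function.comp_def] at this
  rw [nucNorm]
  refine Eq.trans ?_ (this.symm.trans ?_)
  · rfl
  · exact sum_congr rfl fun i _ => Real.sqrt_sq (hc i)

/-- Every matrix is a combination of rank-one matrices whose weights add up to its nuclear norm. -/
theorem exists_eq_sum_rank1 (Z : Matrix (Fin n₁) (Fin n₂) ℝ) :
    ∃ (s : Fin n₁ → ℝ) (u : Fin n₁ → Fin n₁ → ℝ) (v : Fin n₁ → Fin n₂ → ℝ),
      (∀ i, 0 ≤ s i) ∧ (∀ i, ∑ a, u i a ^ 2 ≤ 1) ∧ (∀ i, ∑ b, v i b ^ 2 ≤ 1) ∧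
      ∑ i, s i = nucNorm Z ∧ Z = ∑ i, rank1 (s i) (u i) (v i) := by
  set hZ := isHermitian_mul_conjTranspose_self Z
  let e := hZ.eigenvectorBasis
  let y : Fin n₁ → Fin n₂ → ℝ := fun i => Zᵀ *ᵥ (e i)
  have he1 : ∀ i, ∑ a, e i a ^ 2 = 1 := fun i => by
    have := e.orthonormal.1 i
    rw [EuclideanSpace.norm_eq, Real.sqrt_eq_one] at this
    simpa using this
  have hy : ∀ i, ∑ b, y i b ^ 2 = hZ.eigenvalues i := fun i => by
    have h1 : ∑ b, y i b ^ 2 = y i ⬝ᵥ y i := by simp [dotProduct, sq]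
    have h2 : (e i : Fin n₁ → ℝ) ⬝ᵥ (e i) = 1 := by rw [← he1 i]; simp [dotProduct, sq]
    have h3 : Z *ᵥ (Zᵀ *ᵥ (e i)) = hZ.eigenvalues i • (e i : Fin n₁ → ℝ) := by
      rw [mulVec_mulVec, ← conjTranspose_eq_transpose_of_trivial]
      exact hZ.mulVec_eigenvectorBasis i
    rw [h1]
    simp only [y]
    rw [dotProduct_mulVec, vecMul_transpose, h3, smul_dotProduct, h2, smul_eq_mul, mul_one]
  have hlam : ∀ i, 0 ≤ hZ.eigenvalues i := fun i => by
    rw [← hy]; exact sum_nonneg fun _ _ => sq_nonneg _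
  refine ⟨fun i => √(hZ.eigenvalues i), fun i => e i,
    fun i b => y i b / √(hZ.eigenvalues i), fun i => Real.sqrt_nonneg _, fun i => (he1 i).le,
    fun i => ?_, rfl, ?_⟩
  · simp_rw [div_pow, ← sum_div, hy, Real.sq_sqrt (hlam i)]
    exact div_self_le_one _
  · ext a b
    have h4 : ∀ i, rank1 (√(hZ.eigenvalues i)) (e i)
        (fun b => y i b / √(hZ.eigenvalues i)) a b = e i a * y i b := fun i => by
      simp only [rank1, of_apply]
      rcases (hlam i).eq_or_lt with h0 | hpos
      · have hyb : y i b = 0 := by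
          have := (sum_eq_zero_iff_of_nonneg fun _ _ => sq_nonneg _).1 ((hy i).trans h0.symm) b
            (mem_univ _)
          simpa using this
        simp [hyb]
      · have := (Real.sqrt_pos.2 hpos).ne'
        field_simp
    rw [Matrix.sum_apply]
    simp_rw [h4]
    let z : EuclideanSpace ℝ (Fin n₁) := WithLp.toLp 2 fun a => Z a b
    have h5 := congrArg (fun x : EuclideanSpace ℝ (Fin n₁) => x a) (e.sum_repr' z)
    simp only [WithLp.ofLp_sum, Finset.sum_apply, WithLp.ofLp_smul, Pi.smul_apply,
      smul_eq_mul] at h5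
    change _ = Z a b at h5
    rw [← h5]
    refine sum_congr rfl fun i _ => ?_
    rw [mul_comm]
    congr 1

/-- The pair `(a, b)` as a single Euclidean vector, scaled by `1 / √2`. -/
noncomputable def halfStack (a : Fin n₁ → ℝ) (b : Fin n₂ → ℝ) :
    EuclideanSpace ℝ (Fin n₁ ⊕ Fin n₂) :=
  (√2)⁻¹ • WithLp.toLp 2 (Sum.elim a b)

theorem inner_halfStack (a : Fin n₁ → ℝ) (b : Fin n₂ → ℝ)
    (z : EuclideanSpace ℝ (Fin n₁ ⊕ Fin n₂)) :
    inner ℝ (halfStack a b) z =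
      (√2)⁻¹ * (∑ i, a i * z (Sum.inl i) + ∑ j, b j * z (Sum.inr j)) := by
  simp [halfStack, inner_smul_left, PiLp.inner_apply, mul_comm]

theorem inner_halfStack_halfStack (a c : Fin n₁ → ℝ) (b d : Fin n₂ → ℝ) :
    inner ℝ (halfStack a b) (halfStack c d) = (∑ i, a i * c i + ∑ j, b j * d j) / 2 := by
  have h2 : (√2)⁻¹ * (√2)⁻¹ = (2 : ℝ)⁻¹ := by
    rw [← mul_inv, Real.mul_self_sqrt zero_le_two]
  rw [inner_halfStack]
  simp only [halfStack, WithLp.ofLp_smul, Pi.smul_apply, Sum.elim_inl, Sum.elim_inr, smul_eq_mul,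
    mul_left_comm _ (√2)⁻¹, ← mul_sum, ← mul_add]
  rw [← mul_assoc, h2]
  ring

theorem orthonormal_halfStack {u : Fin n₁ → Fin n₁ → ℝ} {v : Fin n₁ → Fin n₂ → ℝ}
    (hu : ∀ i j, ∑ a, u i a * u j a = if i = j then (1 : ℝ) else 0)
    (hv : ∀ i j, ∑ b, v i b * v j b = if i = j then (1 : ℝ) else 0) :
    Orthonormal ℝ (Sum.elim (fun i => halfStack (u i) (v i)) fun i => halfStack (u i) (-v i)) := by
  rw [orthonormal_iff_ite]
  rintro (i | i) (j | j) <;>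
    simp only [Sum.elim_inl, Sum.elim_inr, inner_halfStack_halfStack, Pi.neg_apply, mul_neg,
      neg_mul, neg_neg, sum_neg_distrib, hu, hv, Sum.inl.injEq, Sum.inr.injEq, reduceCtorEq] <;>
    split_ifs <;> simp_all

theorem inner_halfStack_sq_sub (a : Fin n₁ → ℝ) (b : Fin n₂ → ℝ)
    (z : EuclideanSpace ℝ (Fin n₁ ⊕ Fin n₂)) :
    inner ℝ (halfStack a b) z ^ 2 - inner ℝ (halfStack a (-b)) z ^ 2 =
      2 * ((∑ i, a i * z (Sum.inl i)) * ∑ j, b j * z (Sum.inr j)) := by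
  have h2 : (√2)⁻¹ ^ 2 = (2 : ℝ)⁻¹ := by rw [inv_pow, Real.sq_sqrt zero_le_two]
  simp only [inner_halfStack, mul_pow, h2, Pi.neg_apply, neg_mul, sum_neg_distrib]
  ring

theorem dotProduct_sum_rank1_mulVec (c : Fin n₁ → ℝ) (u : Fin n₁ → Fin n₁ → ℝ)
    (v : Fin n₁ → Fin n₂ → ℝ) (x : Fin n₁ → ℝ) (y : Fin n₂ → ℝ) :
    x ⬝ᵥ (∑ i, rank1 (c i) (u i) (v i)) *ᵥ y =
      ∑ i, c i * ((∑ a, u i a * x a) * ∑ b, v i b * y b) := by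
  rw [Matrix.sum_mulVec]
  refine (dotProduct_sum _ _ _).trans (sum_congr rfl fun i _ => ?_)
  rw [sum_mul_sum, mul_sum]
  simp only [dotProduct, mulVec, rank1, of_apply, mul_sum]
  refine sum_congr rfl fun a _ => sum_congr rfl fun b _ => ?_
  ring

theorem two_mul_dotProduct_sum_rank1_mulVec (c : Fin n₁ → ℝ) (u : Fin n₁ → Fin n₁ → ℝ)
    (v : Fin n₁ → Fin n₂ → ℝ) (z : EuclideanSpace ℝ (Fin n₁ ⊕ Fin n₂)) :
    2 * ((fun i => z (Sum.inl i)) ⬝ᵥ (∑ i, rank1 (c i) (u i) (v i)) *ᵥ fun j => z (Sum.inr j)) =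
      ∑ i, c i * (inner ℝ (halfStack (u i) (v i)) z ^ 2 -
        inner ℝ (halfStack (u i) (-v i)) z ^ 2) := by
  rw [dotProduct_sum_rank1_mulVec, mul_sum]
  refine sum_congr rfl fun i _ => ?_
  rw [inner_halfStack_sq_sub]
  ring

/-- Mirsky-type inequality: signed partial sums of singular values are `1`-Lipschitz in the
nuclear norm. -/
theorem signed_sum_singular_values_le {X G Z : Matrix (Fin n₁) (Fin n₂) ℝ} (hXGZ : X = G + Z)
    {σ τ : Fin n₁ → ℝ} {u p : Fin n₁ → Fin n₁ → ℝ} {v q : Fin n₁ → Fin n₂ → ℝ}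
    (hσ : ∀ i, 0 ≤ σ i) (hσa : Antitone σ)
    (hu : ∀ i j, ∑ a, u i a * u j a = if i = j then (1 : ℝ) else 0)
    (hv : ∀ i j, ∑ b, v i b * v j b = if i = j then (1 : ℝ) else 0)
    (hX : X = ∑ i, rank1 (σ i) (u i) (v i))
    (hτ : ∀ i, 0 ≤ τ i) (hτa : Antitone τ)
    (hp : ∀ i j, ∑ a, p i a * p j a = if i = j then (1 : ℝ) else 0)
    (hq : ∀ i j, ∑ b, q i b * q j b = if i = j then (1 : ℝ) else 0)
    (hG : G = ∑ i, rank1 (τ i) (p i) (q i)) (E : Finset (Fin n₁)) :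
    ∑ i ∈ E, σ i - ∑ i ∈ Eᶜ, σ i ≤ ∑ i ∈ E, τ i - ∑ i ∈ Eᶜ, τ i + nucNorm Z := by
  obtain ⟨s, x, y, hs, hx, hy, hsum, hZ⟩ := exists_eq_sum_rank1 Z
  rw [← hsum]
  refine signed_sum_sub_le (orthonormal_halfStack hu hv) hσ hσa (orthonormal_halfStack hp hq) hτ
    hτa s hs (fun l => halfStack (x l) (y l)) (fun l => ?_) (fun z => ?_) E
  · rw [← sq_le_one_iff₀ (norm_nonneg _), ← real_inner_self_eq_norm_sq, inner_halfStack_halfStack]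
    have h1 := hx l
    have h2 := hy l
    simp only [sq] at h1 h2
    linarith
  · rw [← two_mul_dotProduct_sum_rank1_mulVec, ← two_mul_dotProduct_sum_rank1_mulVec, ← hX, ← hG,
      hXGZ, add_mulVec, dotProduct_add, mul_add]
    gcongr
    rw [hZ, two_mul_dotProduct_sum_rank1_mulVec]
    refine sum_le_sum fun l _ => mul_le_mul_of_nonneg_left ?_ (hs l)
    exact sub_le_self _ (sq_nonneg _)

end MatrixSVD

theorem le_of_null_space_of_cone {x τ η a ε κ lam β₁ β₂ : ℝ} (hη : 0 ≤ η) (hε : 0 ≤ ε)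
    (hκ : 0 < κ) (hlam : 0 < lam) (hβ₁ : 0 < β₁) (hβ₂ : 0 ≤ β₂) (hβ₂1 : β₂ < 1) (hτ : 0 ≤ τ)
    (hcone : a ^ 2 - 2 * ε * a ≤ 2 * lam * (κ * x - τ + 2 * η))
    (hnull : x ≤ β₁ * a + β₂ * (τ / κ)) :
    x ≤ ((2 * κ * β₁ * (1 + β₂) * lam + 4 * β₂ * ε) /
          ((1 - β₂) * (κ ^ 2 * β₁ * lam + κ * ε))) * η +
        (2 * (κ * β₁ * lam + β₂ * ε) * (κ * β₁ * lam + ε)) / (κ * (1 - β₂) * lam) := by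
  set c := κ * β₁ * lam + ε with hc
  have hc0 : 0 < c := by positivity
  have hb : 0 < 1 - β₂ := by linarith
  have hκx : κ * x ≤ κ * β₁ * a + β₂ * τ := by
    calc κ * x ≤ κ * (β₁ * a + β₂ * (τ / κ)) := by gcongr
      _ = κ * β₁ * a + β₂ * τ := by field_simp
  have hquad : a ^ 2 ≤ 2 * c * a + 4 * lam * η := by
    have : lam * (κ * x - τ) ≤ lam * (κ * β₁ * a) := by
      gcongr
      nlinarith
    rw [hc]
    linarith
  have ha : a ≤ 2 * c + 2 * lam * η / c := by
    by_contra! h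
    have hd : 0 ≤ 2 * lam * η / c := by positivity
    have hdc : 2 * lam * η / c * c = 2 * lam * η := by field_simp
    nlinarith
  have hxa : (1 - β₂) * (κ * lam) * x ≤ (κ * β₁ * lam + β₂ * ε) * a + 2 * β₂ * lam * η := by
    have h1 : lam * τ ≤ lam * (κ * x) + 2 * lam * η + ε * a := by nlinarith [sq_nonneg a]
    have h2 := mul_le_mul_of_nonneg_left h1 hβ₂
    have h3 := mul_le_mul_of_nonneg_left hκx hlam.le
    linarith
  have hfin : (1 - β₂) * (κ * lam) * x ≤
      (κ * β₁ * lam + β₂ * ε) * (2 * c + 2 * lam * η / c) + 2 * β₂ * lam * η :=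
    hxa.trans (by gcongr)
  have hpos : 0 < (1 - β₂) * (κ * lam) := by positivity
  have hden : κ ^ 2 * β₁ * lam + κ * ε = κ * c := by rw [hc]; ring
  refine le_of_mul_le_mul_left (hfin.trans (le_of_eq ?_)) hpos
  rw [hden]
  have hcne := hc0.ne'
  have hbne := hb.ne'
  field_simp
  rw [hc]
  ring

theorem stmt13 {n₁ n₂ m k : ℕ} (hk : 0 < k) (hn : n₁ ≤ n₂)
    (A : Matrix (Fin n₁) (Fin n₂) ℝ →ₗ[ℝ] EuclideanSpace ℝ (Fin m))
    (t δ : ℝ) (ht : 1 < t) (hδ0 : 0 < δ)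
    (hδ : δ < Real.sqrt ((t - 1) / t))
    (hRIP : HasRIP A ⌈t * (k : ℝ)⌉₊ δ)
    (X : Matrix (Fin n₁) (Fin n₂) ℝ)
    -- SVD of `X`, with singular values `σX` in decreasing order
    (σX : Fin n₁ → ℝ) (uX : Fin n₁ → Fin n₁ → ℝ) (vX : Fin n₁ → Fin n₂ → ℝ)
    (hσX0 : ∀ i, 0 ≤ σX i) (hσXmono : ∀ i j : Fin n₁, i ≤ j → σX j ≤ σX i)
    (huX : ∀ i j, ∑ a, uX i a * uX j a = if i = j then (1 : ℝ) else 0)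
    (hvX : ∀ i j, ∑ b, vX i b * vX j b = if i = j then (1 : ℝ) else 0)
    (hX : X = ∑ i, rank1 (σX i) (uX i) (vX i))
    (nv : EuclideanSpace ℝ (Fin m)) (ε : ℝ) (hnv : ‖nv‖ ≤ ε)
    (b : EuclideanSpace ℝ (Fin m)) (hb : b = A X + nv)
    (lam : ℝ) (hlam : 0 < lam)
    (Xs : Matrix (Fin n₁) (Fin n₂) ℝ)
    (hXs : ∀ Z : Matrix (Fin n₁) (Fin n₂) ℝ,
      nucNorm Xs + (1 / (2 * lam)) * ‖b - A Xs‖ ^ 2 ≤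
        nucNorm Z + (1 / (2 * lam)) * ‖b - A Z‖ ^ 2)
    -- SVD of `H = Xs - X`, with singular values `σH` in decreasing order
    (σH : Fin n₁ → ℝ) (uH : Fin n₁ → Fin n₁ → ℝ) (vH : Fin n₁ → Fin n₂ → ℝ)
    (hσH0 : ∀ i, 0 ≤ σH i) (hσHmono : ∀ i j : Fin n₁, i ≤ j → σH j ≤ σH i)
    (huH : ∀ i j, ∑ a, uH i a * uH j a = if i = j then (1 : ℝ) else 0)
    (hvH : ∀ i j, ∑ b, vH i b * vH j b = if i = j then (1 : ℝ) else 0)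
    (hH : Xs - X = ∑ i, rank1 (σH i) (uH i) (vH i))
    -- `E = {1, …, k}`
    (E : Finset (Fin n₁)) (hEdef : E = univ.filter fun i : Fin n₁ => (i : ℕ) < k)
    (β₁ β₂ : ℝ)
    (hβ₁ : β₁ = 2 / ((1 - δ) * Real.sqrt (1 + δ)))
    (hβ₂ : β₂ = δ / Real.sqrt ((1 - δ ^ 2) * (t - 1))) :
    frobNorm (∑ i ∈ E, rank1 (σH i) (uH i) (vH i)) ≤
      ((2 * Real.sqrt k * β₁ * (1 + β₂) * lam + 4 * β₂ * ε) /
          ((1 - β₂) * (k * β₁ * lam + Real.sqrt k * ε))) * (∑ i ∈ Eᶜ, σX i) +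
        (2 * (Real.sqrt k * β₁ * lam + β₂ * ε) * (Real.sqrt k * β₁ * lam + ε)) /
          (Real.sqrt k * (1 - β₂) * lam) := by
  have hk0 : (0 : ℝ) < k := by exact_mod_cast hk
  have hε : 0 ≤ ε := (norm_nonneg _).trans hnv
  have ht0 : 0 < t := by linarith
  have hδt : δ ^ 2 * t < t - 1 := by
    have h := (Real.lt_sqrt hδ0.le).1 hδ
    rwa [lt_div_iff₀ ht0] at h
  have hδ1 : δ < 1 := by
    by_contra! h
    nlinarith [one_le_pow₀ h (n := 2)]
  have hβ₁0 : 0 < β₁ := by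
    rw [hβ₁]
    have : 0 < 1 - δ := by linarith
    positivity
  have hβ₂0 : 0 ≤ β₂ := by rw [hβ₂]; positivity
  have hβ₂1 : β₂ < 1 := by
    have h : δ < √((1 - δ ^ 2) * (t - 1)) := Real.lt_sqrt_of_sq_lt (by nlinarith)
    rw [hβ₂]
    exact (div_lt_one (hδ0.trans h)).2 h
  have hE : #E ≤ k := by
    rw [hEdef, ← card_map Fin.valEmbedding]
    refine (card_le_card fun i hi => ?_ : _ ≤ #(range k)).trans (card_range k).le
    simp only [mem_map, mem_filter, mem_univ, true_and, Fin.valEmbedding_apply] at hi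
    obtain ⟨j, hj, rfl⟩ := hi
    exact mem_range.2 hj
  have hfrob : frobNorm (∑ i ∈ E, rank1 (σH i) (uH i) (vH i)) = √(∑ i ∈ E, σH i ^ 2) := by
    have h : ∑ i ∈ E, rank1 (σH i) (uH i) (vH i) =
        ∑ i, rank1 (if i ∈ E then σH i else 0) (uH i) (vH i) := by
      rw [← sum_subset (subset_univ E)]
      · exact sum_congr rfl fun i hi => by rw [if_pos hi]
      · intro i _ hi
        rw [if_neg hi]
        ext a b
        simp [rank1]
    have h0 : 0 ≤ frobNorm (∑ i, rank1 (if i ∈ E then σH i else 0) (uH i) (vH i)) :=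
      Real.sqrt_nonneg _
    rw [h, ← Real.sqrt_sq h0, frobNorm_sum_rank1_sq huH hvH]
    simp [ite_pow, sum_ite_mem]
  let B : (Fin n₁ → ℝ) →ₗ[ℝ] EuclideanSpace ℝ (Fin m) := A ∘ₗ
    { toFun := fun c => ∑ i, rank1 (c i) (uH i) (vH i)
      map_add' := fun c d => by
        rw [← sum_add_distrib]
        refine sum_congr rfl fun i _ => ?_
        ext a b
        simp [rank1, add_mul]
      map_smul' := fun s c => by
        rw [smul_sum]
        refine sum_congr rfl fun i _ => ?_
        ext a b
        simp [rank1, mul_assoc] }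
  have hBσ : B σH = A (Xs - X) := by rw [hH]; rfl
  have hnull := robust_null_space_of_rip B k ⌈t * (k : ℝ)⌉₊ t δ hk ht (Nat.le_ceil _) hδ0 hδ1
    (fun c hc => by
      rw [← frobNorm_sum_rank1_sq (c := c) huH hvH]
      exact hRIP _ ((rank_sum_rank1_le c uH vH).trans hc)) σH hσH0 E hE
  rw [← hβ₁, ← hβ₂, hBσ] at hnull
  have hobj : ‖A (Xs - X)‖ ^ 2 - 2 * ε * ‖A (Xs - X)‖ ≤
      2 * lam * (nucNorm X - nucNorm Xs) := by
    have h := hXs X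
    have h1 : b - A X = nv := by rw [hb]; abel
    have h2 : b - A Xs = nv - A (Xs - X) := by rw [hb, map_sub]; abel
    rw [h1, h2, norm_sub_sq_real] at h
    have h3 : inner ℝ nv (A (Xs - X)) ≤ ε * ‖A (Xs - X)‖ :=
      (real_inner_le_norm _ _).trans (mul_le_mul_of_nonneg_right hnv (norm_nonneg _))
    have h4 : 1 / (2 * lam) * (‖A (Xs - X)‖ ^ 2 - 2 * inner ℝ nv (A (Xs - X))) ≤
        nucNorm X - nucNorm Xs := by linarith
    rw [one_div, inv_mul_le_iff₀ (by positivity)] at h4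
    linarith
  have hnuc : nucNorm X = ∑ i ∈ E, σX i + ∑ i ∈ Eᶜ, σX i := by
    rw [sum_add_sum_compl, hX, nucNorm_sum_rank1 huX hvX hσX0]
  have hneg : -(Xs - X) = ∑ i, rank1 (σH i) (-uH i) (vH i) := by
    rw [hH, ← sum_neg_distrib]
    refine sum_congr rfl fun i _ => ?_
    ext a b
    simp [rank1]
  have hsing := signed_sum_singular_values_le (X := X) (G := -(Xs - X)) (Z := Xs) (by abel)
    hσX0 (fun i j h => hσXmono i j h) huX hvX hX hσH0 (fun i j h => hσHmono i j h)
    (fun i j => by simpa using huH i j) hvH hneg E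
  have hsum : ∑ i ∈ E, σH i ≤ √k * √(∑ i ∈ E, σH i ^ 2) := by
    rw [← Real.sqrt_mul hk0.le]
    refine Real.le_sqrt_of_sq_le (sq_sum_le_card_mul_sum_sq.trans ?_)
    gcongr
  have hcone : ‖A (Xs - X)‖ ^ 2 - 2 * ε * ‖A (Xs - X)‖ ≤
      2 * lam * (√k * √(∑ i ∈ E, σH i ^ 2) - ∑ i ∈ Eᶜ, σH i + 2 * ∑ i ∈ Eᶜ, σX i) :=
    hobj.trans (mul_le_mul_of_nonneg_left (by linarith) (by positivity))
  have hmain := le_of_null_space_of_cone (sum_nonneg fun i _ => hσX0 i) hε (Real.sqrt_pos.2 hk0)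
    hlam hβ₁0 hβ₂0 hβ₂1 (sum_nonneg fun i _ => hσH0 i) hcone hnull
  rw [Real.sq_sqrt hk0.le] at hmain
  rw [hfrob]
  exact hmain
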